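/- arXiv:1104.3908 — 2 statements merged into one kernel-verified Lean document; each statement's English description precedes it below -/
import Mathlib

section
/- Let f : ℝ^n → ℂ be a smooth function. The following three conditions are equivalent: (i) for every multi-index α ∈ ℕ^n there exists a polynomial P_α on ℝ^n such that |∂^α f(x)| ≤ |P_α(x)| for every x ∈ ℝ^n; (ii) for every Schwartz function φ ∈ 𝒮_n, the pointwise product f·φ is again a Schwartz function; (iii) for every multi-index α ∈ ℕ^n and every Schwartz function φ ∈ 𝒮_n, the product (∂^α f)·φ is a bounded function on ℝ^n. -/
open SchwartzMap

/-- The partial derivative of `f : ℝ^n → ℂ` in the `i`-th coordinate direction. -/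
noncomputable def pDeriv {n : ℕ} (i : Fin n) (f : (Fin n → ℝ) → ℂ) : (Fin n → ℝ) → ℂ :=
  fun x => fderiv ℝ f x (Pi.single i 1)

/-- The multi-index partial derivative `∂^α f` of `f : ℝ^n → ℂ`. -/
noncomputable def multiDeriv {n : ℕ} (α : Fin n → ℕ) (f : (Fin n → ℝ) → ℂ) :
    (Fin n → ℝ) → ℂ :=
  (List.finRange n).foldr (fun i g => (pDeriv i)^[α i] g) f

open Function Filter LineDeriv
open scoped ContDiff

section GrowthFromBoundedProducts

variable {E F : Type*} [NormedAddCommGroup E] [NormedSpace ℝ E]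
  [NormedAddCommGroup F] [NormedSpace ℝ F]

/-- A series of Schwartz functions which is absolutely summable for every Schwartz seminorm
converges pointwise to a Schwartz function. -/
theorem exists_schwartzMap_hasSum [CompleteSpace F] (u : ℕ → 𝓢(E, F))
    (hu : ∀ m j : ℕ, ∃ v : ℕ → ℝ, Summable v ∧
      ∀ k x, ‖x‖ ^ m * ‖iteratedFDeriv ℝ j (u k) x‖ ≤ v k) :
    ∃ φ : 𝓢(E, F), ∀ x, HasSum (fun k => u k x) (φ x) := by
  choose v hv hb using hu
  have hu_smooth : ∀ k, ContDiff ℝ ((⊤ : ℕ∞) : ℕ∞ω) (u k) := fun k => (u k).smooth ⊤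
  have hv0 : ∀ j : ℕ, ((j : ℕ∞) ≤ ⊤) → Summable (v 0 j) := fun j _ => hv 0 j
  have hb0 : ∀ (j k : ℕ) (x : E), ((j : ℕ∞) ≤ ⊤) → ‖iteratedFDeriv ℝ j (u k) x‖ ≤ v 0 j k :=
    fun j k x _ => by simpa using hb 0 j k x
  refine ⟨⟨fun x => ∑' k, u k x, contDiff_tsum hu_smooth hv0 hb0, fun m j => ?_⟩, fun x => ?_⟩
  · refine ⟨∑' k, v m j k, fun x => ?_⟩
    rw [iteratedFDeriv_tsum_apply hu_smooth hv0 hb0 le_top]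
    have hs : Summable fun k => ‖iteratedFDeriv ℝ j (u k) x‖ :=
      .of_nonneg_of_le (fun _ => norm_nonneg _) (fun k => hb0 j k x le_top) (hv 0 j)
    calc _ ≤ ‖x‖ ^ m * ∑' k, ‖iteratedFDeriv ℝ j (u k) x‖ := by
          gcongr
          exact norm_tsum_le_tsum_norm hs
      _ = ∑' k, ‖x‖ ^ m * ‖iteratedFDeriv ℝ j (u k) x‖ := tsum_mul_left.symm
      _ ≤ ∑' k, v m j k := (hs.mul_left _).tsum_le_tsum (fun k => hb m j k x) (hv m j)
  · exact (Summable.of_norm_bounded (hv 0 0) fun k => by simpa using hb 0 0 k x).hasSum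

theorem exists_bound_of_forall_schwartzMap_mul_bounded [FiniteDimensional ℝ E] (g : E → ℂ)
    (hg : ∀ φ : 𝓢(E, ℂ), ∃ C : ℝ, ∀ x, ‖g x * φ x‖ ≤ C) :
    ∃ (k : ℕ) (C : ℝ), ∀ x, ‖g x‖ ≤ C * (1 + ‖x‖) ^ k := by
  by_contra! h
  choose x hx using fun k : ℕ => h k (4 ^ k)
  let β : ContDiffBump (0 : E) := default
  have hβ : HasCompactSupport fun y => (β y : ℂ) := β.hasCompactSupport.comp_left Complex.ofReal_zero
  let b : 𝓢(E, ℂ) := hβ.toSchwartzMap (Complex.ofRealCLM.contDiff.comp β.contDiff)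
  have hb : ∀ y, b y = (β y : ℂ) := fun y => rfl
  let c : ℕ → ℝ := fun k => (2 ^ k * (1 + ‖x k‖) ^ k)⁻¹
  have hc : ∀ k, 0 < c k := fun k => by positivity
  let u : ℕ → 𝓢(E, ℂ) := fun k => c k • b.compSubConstCLM ℝ (x k)
  have hu : ∀ k y, u k y = ((c k * β (y - x k) : ℝ) : ℂ) := fun k y => by simp [u, hb]
  obtain ⟨φ, hφ⟩ := exists_schwartzMap_hasSum u fun m j => by
    obtain ⟨A, hA⟩ : ∃ A, ∀ y, (1 + ‖y‖) ^ m * ‖iteratedFDeriv ℝ j b y‖ ≤ A :=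
      ⟨_, fun y => one_add_le_sup_seminorm_apply (𝕜 := ℝ) (m := (m, j)) le_rfl le_rfl b y⟩
    have hA0 : 0 ≤ A := le_trans (by positivity) (hA 0)
    refine ⟨fun k => c k * (1 + ‖x k‖) ^ m * A, ?_, fun k y => ?_⟩
    · refine Summable.of_norm_bounded_eventually_nat (g := fun k => (1 / 2 : ℝ) ^ k * A)
        (summable_geometric_two.mul_right A) ?_
      filter_upwards [eventually_ge_atTop m] with k hk
      rw [Real.norm_of_nonneg (mul_nonneg (mul_nonneg (hc k).le (by positivity)) hA0)]
      gcongr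
      have hpow : (1 + ‖x k‖) ^ m ≤ (1 + ‖x k‖) ^ k :=
        pow_le_pow_right₀ (by linarith [norm_nonneg (x k)]) hk
      calc c k * (1 + ‖x k‖) ^ m ≤ c k * (1 + ‖x k‖) ^ k := by gcongr
        _ = (1 / 2) ^ k := by
          have : (1 + ‖x k‖) ^ k ≠ 0 := by positivity
          simp only [c, one_div, inv_pow]; field_simp
    · have hD : ‖iteratedFDeriv ℝ j (u k) y‖ = c k * ‖iteratedFDeriv ℝ j b (y - x k)‖ := by
        have : ⇑(u k) = c k • fun z => b (z - x k) := rfl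
        rw [this, iteratedFDeriv_const_smul_apply, iteratedFDeriv_comp_sub, norm_smul,
          Real.norm_of_nonneg (hc k).le]
        exact ((b.smooth j).comp (contDiff_id.sub contDiff_const)).contDiffAt
      have hy : ‖y‖ ≤ (1 + ‖x k‖) * (1 + ‖y - x k‖) := by
        have := norm_le_norm_add_norm_sub' y (x k)
        nlinarith [mul_nonneg (norm_nonneg (x k)) (norm_nonneg (y - x k))]
      calc ‖y‖ ^ m * ‖iteratedFDeriv ℝ j (u k) y‖
          ≤ ((1 + ‖x k‖) * (1 + ‖y - x k‖)) ^ m * (c k * ‖iteratedFDeriv ℝ j b (y - x k)‖) := by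
            rw [hD]
            have := (hc k).le
            gcongr
        _ = c k * (1 + ‖x k‖) ^ m * ((1 + ‖y - x k‖) ^ m * ‖iteratedFDeriv ℝ j b (y - x k)‖) := by
            rw [mul_pow]; ring
        _ ≤ c k * (1 + ‖x k‖) ^ m * A := by
            have := (hc k).le
            gcongr
            exact hA _
  have hle : ∀ k, c k ≤ ‖φ (x k)‖ := fun k => by
    have hre : HasSum (fun l => c l * β (x k - x l)) (φ (x k)).re := by
      simpa only [hu, Complex.ofReal_re] using Complex.hasSum_re (hφ (x k))
    have h1 := le_hasSum hre k fun l _ => mul_nonneg (hc l).le β.nonneg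
    have h2 : β (x k - x k) = 1 := by
      rw [sub_self]
      exact β.one_of_mem_closedBall (Metric.mem_closedBall_self β.rIn_pos.le)
    rw [h2, mul_one] at h1
    exact h1.trans (Complex.re_le_norm _)
  obtain ⟨C, hC⟩ := hg φ
  obtain ⟨k, hk⟩ := pow_unbounded_of_one_lt C (one_lt_two : (1 : ℝ) < 2)
  refine (hC (x k)).not_gt (hk.trans_le ?_)
  calc (2 : ℝ) ^ k = 4 ^ k * (1 + ‖x k‖) ^ k * c k := by
        have : (1 + ‖x k‖) ^ k ≠ 0 := by positivity
        simp only [c]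
        field_simp
        rw [← pow_mul, mul_comm, pow_mul]; norm_num
    _ ≤ ‖g (x k)‖ * ‖φ (x k)‖ := by
        gcongr
        exacts [(hx k).le, hle k]
    _ = ‖g (x k) * φ (x k)‖ := (norm_mul _ _).symm

end GrowthFromBoundedProducts

section PolynomialBounds

variable {n : ℕ}

theorem MvPolynomial.hasTemperateGrowth_eval (P : MvPolynomial (Fin n) ℝ) :
    HasTemperateGrowth fun x : Fin n → ℝ => MvPolynomial.eval x P := by
  induction P using MvPolynomial.induction_on with
  | C a => simp
  | add p q hp hq => simp only [map_add]; exact hp.add hq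
  | mul_X p i hp =>
    simp only [map_mul, MvPolynomial.eval_X]
    exact hp.mul (ContinuousLinearMap.proj (R := ℝ) (φ := fun _ : Fin n => ℝ) i).hasTemperateGrowth

theorem exists_abs_eval_ge_mul_one_add_norm_pow (k : ℕ) (C : ℝ) :
    ∃ P : MvPolynomial (Fin n) ℝ, ∀ x : Fin n → ℝ,
      C * (1 + ‖x‖) ^ k ≤ |MvPolynomial.eval x P| := by
  refine ⟨.C C * (2 + ∑ i, .X i ^ 2) ^ k, fun x => ?_⟩
  have hs : 0 ≤ ∑ i, x i ^ 2 := Finset.sum_nonneg fun i _ => sq_nonneg _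
  have hx : ‖x‖ ≤ 1 + ∑ i, x i ^ 2 := by
    refine (pi_norm_le_iff_of_nonneg (by positivity)).2 fun i => ?_
    have h1 : x i ^ 2 ≤ ∑ i, x i ^ 2 :=
      Finset.single_le_sum (f := fun i => x i ^ 2) (fun i _ => sq_nonneg _) (Finset.mem_univ i)
    rw [Real.norm_eq_abs]
    nlinarith [sq_abs (x i), sq_nonneg (|x i| - 1)]
  have he : MvPolynomial.eval x (.C C * (2 + ∑ i, .X i ^ 2) ^ k) = C * (2 + ∑ i, x i ^ 2) ^ k := by
    simp
  rw [he, abs_mul, abs_of_nonneg (a := (2 + ∑ i, x i ^ 2) ^ k) (by positivity)]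
  exact mul_le_mul (le_abs_self C) (pow_le_pow_left₀ (by positivity) (by linarith) k)
    (by positivity) (abs_nonneg C)

end PolynomialBounds

section PartialDerivatives

variable {n : ℕ} {f : (Fin n → ℝ) → ℂ}

theorem ContDiff.pDeriv (hf : ContDiff ℝ ∞ f) (i : Fin n) : ContDiff ℝ ∞ (pDeriv i f) :=
  (hf.fderiv_right (m := ∞) (by simp)).clm_apply contDiff_const

theorem ContDiff.pDeriv_iterate (hf : ContDiff ℝ ∞ f) (i : Fin n) (k : ℕ) :
    ContDiff ℝ ∞ ((_root_.pDeriv i)^[k] f) := by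
  induction k with
  | zero => exact hf
  | succ k ih => rw [iterate_succ_apply']; exact ih.pDeriv i

theorem pDeriv_comm (hf : ContDiff ℝ ∞ f) (i j : Fin n) :
    pDeriv i (pDeriv j f) = pDeriv j (pDeriv i f) := by
  ext x
  have hd : DifferentiableAt ℝ (fderiv ℝ f) x :=
    (hf.fderiv_right (m := ∞) (by simp)).differentiable (by simp) x
  have key : ∀ a b : Fin n, pDeriv a (pDeriv b f) x =
      fderiv ℝ (fderiv ℝ f) x (Pi.single a 1) (Pi.single b 1) := fun a b => by
    have hb : pDeriv b f = fun y => fderiv ℝ f y (Pi.single b 1) := rfl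
    rw [pDeriv, hb, fderiv_clm_apply hd (differentiableAt_const _)]
    simp
  rw [key, key]
  exact (hf.contDiffAt.isSymmSndFDerivAt (by simpa using ENat.LEInfty.out)) _ _

theorem pDeriv_iterate_comm (hf : ContDiff ℝ ∞ f) (i j : Fin n) (k : ℕ) :
    pDeriv i ((pDeriv j)^[k] f) = (pDeriv j)^[k] (pDeriv i f) := by
  induction k with
  | zero => rfl
  | succ k ih =>
    rw [iterate_succ_apply', iterate_succ_apply', pDeriv_comm (hf.pDeriv_iterate j k), ih]

theorem pDeriv_foldr_comm (hf : ContDiff ℝ ∞ f) (α : Fin n → ℕ) (i : Fin n) (l : List (Fin n)) :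
    ContDiff ℝ ∞ (l.foldr (fun j g => (pDeriv j)^[α j] g) f) ∧
      l.foldr (fun j g => (pDeriv j)^[α j] g) (pDeriv i f) =
        pDeriv i (l.foldr (fun j g => (pDeriv j)^[α j] g) f) := by
  induction l with
  | nil => exact ⟨hf, rfl⟩
  | cons j l ih =>
    simp only [List.foldr_cons]
    exact ⟨ih.1.pDeriv_iterate j _, by rw [ih.2, pDeriv_iterate_comm ih.1]⟩

theorem foldr_pDeriv_eq_foldr_add_single (hf : ContDiff ℝ ∞ f) (α : Fin n → ℕ) (i : Fin n)
    (l : List (Fin n)) (hl : l.Nodup) (hi : i ∈ l) :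
    l.foldr (fun j g => (pDeriv j)^[α j] g) (pDeriv i f) =
      l.foldr (fun j g => (pDeriv j)^[(α + (Pi.single i 1 : Fin n → ℕ)) j] g) f := by
  induction l with
  | nil => simp at hi
  | cons j l ih =>
    rw [List.nodup_cons] at hl
    simp only [List.foldr_cons]
    by_cases hij : i = j
    · subst hij
      have hcongr : l.foldr (fun j g => (pDeriv j)^[(α + (Pi.single i 1 : Fin n → ℕ)) j] g) f =
          l.foldr (fun j g => (pDeriv j)^[α j] g) f := by
        refine List.foldr_ext _ _ _ fun a ha g => ?_
        have : a ≠ i := fun h => hl.1 (h ▸ ha)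
        simp [this]
      rw [hcongr, (pDeriv_foldr_comm hf α i l).2]
      simp
    · rw [ih hl.2 ((List.mem_cons.1 hi).resolve_left hij)]
      simp [Ne.symm hij]

theorem multiDeriv_pDeriv (hf : ContDiff ℝ ∞ f) (α : Fin n → ℕ) (i : Fin n) :
    multiDeriv α (pDeriv i f) = multiDeriv (α + Pi.single i 1) f :=
  foldr_pDeriv_eq_foldr_add_single hf α i _ (List.nodup_finRange n) (List.mem_finRange i)

theorem multiDeriv_zero (f : (Fin n → ℝ) → ℂ) : multiDeriv 0 f = f := by
  unfold multiDeriv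
  induction List.finRange n with
  | nil => rfl
  | cons j l ih => simp

theorem fderiv_eq_sum_pDeriv (f : (Fin n → ℝ) → ℂ) :
    fderiv ℝ f = ∑ i, ContinuousLinearMap.smulRightL ℝ (Fin n → ℝ) ℂ
      (ContinuousLinearMap.proj i) ∘ pDeriv i f := by
  ext x v
  have h := (fderiv ℝ f x).toLinearMap.pi_apply_eq_sum_univ v
  simp only [ContinuousLinearMap.coe_coe] at h
  have hs (i : Fin n) : (fun j => if i = j then 1 else 0) = (Pi.single i 1 : Fin n → ℝ) := by
    ext j
    simp [Pi.single_apply, eq_comm]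
  simp [h, hs, pDeriv]

/-- A smooth function whose partial derivatives of all orders are polynomially bounded has
temperate growth. -/
theorem hasTemperateGrowth_of_multiDeriv_bound (hf : ContDiff ℝ ∞ f)
    (hb : ∀ α : Fin n → ℕ, ∃ (k : ℕ) (C : ℝ), ∀ x, ‖multiDeriv α f x‖ ≤ C * (1 + ‖x‖) ^ k) :
    HasTemperateGrowth f := by
  refine ⟨hf, fun m => ?_⟩
  induction m generalizing f with
  | zero => simpa [multiDeriv_zero] using hb 0
  | succ m ih =>
    choose k C h using fun i => ih (hf.pDeriv i) fun α => by
      simpa only [multiDeriv_pDeriv hf] using hb (α + Pi.single i 1)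
    let L : Fin n → ℂ →L[ℝ] (Fin n → ℝ) →L[ℝ] ℂ := fun i =>
      ContinuousLinearMap.smulRightL ℝ (Fin n → ℝ) ℂ (ContinuousLinearMap.proj i)
    refine ⟨∑ i, k i, ∑ i, ‖L i‖ * |C i|, fun x => ?_⟩
    rw [← norm_iteratedFDeriv_fderiv, fderiv_eq_sum_pDeriv, iteratedFDeriv_sum_apply
      fun i _ => ((L i).contDiff.comp ((hf.pDeriv i).of_le (mod_cast le_top))).contDiffAt,
      Finset.sum_mul]
    refine norm_sum_le_of_le _ fun i _ => ?_
    calc _ ≤ ‖L i‖ * ‖iteratedFDeriv ℝ m (pDeriv i f) x‖ :=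
          (L i).norm_iteratedFDeriv_comp_left (hf.pDeriv i).contDiffAt (mod_cast le_top)
      _ ≤ ‖L i‖ * (|C i| * (1 + ‖x‖) ^ ∑ i, k i) := by
          gcongr
          refine (h i x).trans ?_
          gcongr
          · exact le_abs_self _
          · linarith [norm_nonneg x]
          · exact Finset.single_le_sum (fun _ _ => Nat.zero_le _) (Finset.mem_univ i)
      _ = _ := by ring

/-- The product of `f` with any Schwartz function is a Schwartz function. -/
def IsSchwartzMultiplier (f : (Fin n → ℝ) → ℂ) : Prop :=
  ∀ φ : 𝓢((Fin n → ℝ), ℂ), ∃ ψ : 𝓢((Fin n → ℝ), ℂ), ∀ x, ψ x = f x * φ x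

theorem IsSchwartzMultiplier.pDeriv (hf : ContDiff ℝ ∞ f) (h : IsSchwartzMultiplier f)
    (i : Fin n) : IsSchwartzMultiplier (pDeriv i f) := fun φ => by
  let e : Fin n → ℝ := Pi.single i 1
  obtain ⟨ψ₁, h₁⟩ := h φ
  obtain ⟨ψ₂, h₂⟩ := h (∂_{e} φ)
  refine ⟨∂_{e} ψ₁ - ψ₂, fun x => ?_⟩
  have hψ : ⇑ψ₁ = fun x => f x * φ x := funext h₁
  rw [sub_apply, h₂, lineDerivOp_apply_eq_fderiv, lineDerivOp_apply_eq_fderiv, hψ,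
    fderiv_fun_mul (hf.differentiable (by simp) x) φ.differentiableAt]
  simp [_root_.pDeriv, e]
  ring

theorem IsSchwartzMultiplier.pDeriv_iterate (hf : ContDiff ℝ ∞ f) (h : IsSchwartzMultiplier f)
    (i : Fin n) (k : ℕ) : IsSchwartzMultiplier ((_root_.pDeriv i)^[k] f) := by
  induction k with
  | zero => exact h
  | succ k ih => rw [iterate_succ_apply']; exact ih.pDeriv (hf.pDeriv_iterate i k) i

theorem IsSchwartzMultiplier.multiDeriv (hf : ContDiff ℝ ∞ f) (h : IsSchwartzMultiplier f)
    (α : Fin n → ℕ) : IsSchwartzMultiplier (multiDeriv α f) := by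
  have key : ∀ l : List (Fin n),
      ContDiff ℝ ∞ (l.foldr (fun j g => (_root_.pDeriv j)^[α j] g) f) ∧
        IsSchwartzMultiplier (l.foldr (fun j g => (_root_.pDeriv j)^[α j] g) f) := fun l => by
    induction l with
    | nil => exact ⟨hf, h⟩
    | cons j l ih => exact ⟨ih.1.pDeriv_iterate j _, ih.2.pDeriv_iterate ih.1 j _⟩
  exact (key _).2

end PartialDerivatives

/-- Equivalence, for a smooth `f : ℝ^n → ℂ`, of:
(i) every multi-index derivative `∂^α f` is bounded by a polynomial;
(ii) `f·φ` is a Schwartz function for every Schwartz `φ`;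
(iii) `(∂^α f)·φ` is bounded for every multi-index `α` and Schwartz `φ`. -/
theorem slowlyIncreasing_tfae {n : ℕ} (f : (Fin n → ℝ) → ℂ) (hf : ContDiff ℝ (⊤ : ℕ∞) f) :
    [ (∀ α : Fin n → ℕ, ∃ P : MvPolynomial (Fin n) ℝ, ∀ x : Fin n → ℝ,
        ‖multiDeriv α f x‖ ≤ |MvPolynomial.eval x P|),
      (∀ φ : 𝓢((Fin n → ℝ), ℂ), ∃ ψ : 𝓢((Fin n → ℝ), ℂ), ∀ x, ψ x = f x * φ x),
      (∀ α : Fin n → ℕ, ∀ φ : 𝓢((Fin n → ℝ), ℂ), ∃ C : ℝ, ∀ x : Fin n → ℝ,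
        ‖multiDeriv α f x * φ x‖ ≤ C) ].TFAE := by
  tfae_have 1 → 2 := fun h φ => by
    have hf' : HasTemperateGrowth f := hasTemperateGrowth_of_multiDeriv_bound hf fun α => by
      obtain ⟨P, hP⟩ := h α
      obtain ⟨k, C, hC⟩ := P.hasTemperateGrowth_eval.2 0
      exact ⟨k, C, fun x => (hP x).trans (by simpa using hC x)⟩
    exact ⟨smulLeftCLM ℂ f φ, fun x => by simp [smulLeftCLM_apply_apply hf']⟩
  tfae_have 2 → 3 := fun h α φ => by
    obtain ⟨ψ, hψ⟩ := IsSchwartzMultiplier.multiDeriv hf h α φ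
    obtain ⟨C, hC⟩ := ψ.decay 0 0
    exact ⟨C, fun x => by simpa [hψ] using hC.2 x⟩
  tfae_have 3 → 1 := fun h α => by
    obtain ⟨k, C, hC⟩ := exists_bound_of_forall_schwartzMap_mul_bounded _ (h α)
    obtain ⟨P, hP⟩ := exists_abs_eval_ge_mul_one_add_norm_pow (n := n) k C
    exact ⟨P, fun x => (hC x).trans (hP x)⟩
  tfae_finish
end

section
/- Let T : 𝒮_n → 𝒮_m be a continuous linear operator such that its transpose ᵗT : 𝒮'_m → 𝒮'_n, a ↦ a ∘ T, is bijective. Then T is surjective: for every g ∈ 𝒮_m there exists h ∈ 𝒮_n with T(h) = g. -/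
open SchwartzMap

open Filter Topology Bornology

section WeaklyBounded

variable {𝕜 E : Type*} [RCLike 𝕜] [AddCommGroup E] [Module 𝕜 E]

/-- A set is bounded for a seminorm `p` as soon as every linear functional dominated by a multiple
of `p` is bounded on it. -/
theorem Seminorm.exists_forall_le_of_forall_dual (p : Seminorm 𝕜 E) (s : Set E)
    (hs : ∀ (f : E →ₗ[𝕜] 𝕜) (C : ℝ), (∀ x, ‖f x‖ ≤ C * p x) → ∃ M, ∀ x ∈ s, ‖f x‖ ≤ M) :
    ∃ M, ∀ x ∈ s, p x ≤ M := by
  let _ : SeminormedAddCommGroup E := p.toAddGroupSeminorm.toSeminormedAddCommGroup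
  let _ : NormedSpace 𝕜 E := ⟨fun a x => (map_smul_eq_mul p a x).le⟩
  obtain ⟨M, hM⟩ := banach_steinhaus
    (g := fun i : s => NormedSpace.inclusionInDoubleDual 𝕜 E i) fun f => by
      obtain ⟨M, hM⟩ := hs f.toLinearMap ‖f‖ f.le_opNorm
      exact ⟨M, fun i => hM i i.2⟩
  refine ⟨M, fun x hx => ?_⟩
  have := hM ⟨x, hx⟩
  exact ((NormedSpace.inclusionInDoubleDualLi (E := E) 𝕜).norm_map x).symm.trans_le this

theorem Bornology.IsVonNBounded.exists_norm_le_of_continuous [TopologicalSpace E] {s : Set E}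
    (hs : IsVonNBounded 𝕜 s) (f : E →ₗ[𝕜] 𝕜) (hf : Continuous f) : ∃ M, ∀ x ∈ s, ‖f x‖ ≤ M := by
  obtain ⟨M, hM⟩ := ((NormedSpace.isVonNBounded_iff 𝕜).mp
    (hs.image (⟨f, hf⟩ : E →L[𝕜] 𝕜))).exists_norm_le
  exact ⟨M, fun x hx => hM _ ⟨x, hx, rfl⟩⟩

/-- **Mackey's theorem**: a weakly bounded set is bounded. -/
theorem isVonNBounded_of_forall_dual [TopologicalSpace E] [PolynormableSpace 𝕜 E] {s : Set E}
    (hs : ∀ f : E →L[𝕜] 𝕜, ∃ M, ∀ x ∈ s, ‖f x‖ ≤ M) : IsVonNBounded 𝕜 s := by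
  have hE := PolynormableSpace.withSeminorms 𝕜 E
  have := hE.topologicalAddGroup
  rw [hE.isVonNBounded_iff_seminorm_bddAbove]
  rintro ⟨p, hp⟩
  obtain ⟨M, hM⟩ := p.exists_forall_le_of_forall_dual s fun f C hf => by
    refine hs ⟨f, ?_⟩
    refine continuous_of_continuousAt_zero f ?_
    rw [ContinuousAt, map_zero]
    refine squeeze_zero_norm hf ?_
    have : Continuous fun x => C * p x := by fun_prop
    simpa using this.tendsto 0
  exact ⟨M, by rintro _ ⟨x, hx, rfl⟩; exact hM x hx⟩

variable {F : Type*} [AddCommGroup F] [Module 𝕜 F]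
  [TopologicalSpace E] [PolynormableSpace 𝕜 E]
  [tF : TopologicalSpace F] [IsTopologicalAddGroup F] [ContinuousSMul 𝕜 F]

/-- A continuous linear map into a first countable space whose transpose is surjective induces the
topology of its domain. -/
theorem ContinuousLinearMap.isInducing_of_transpose_surjective [FirstCountableTopology F]
    (T : E →L[𝕜] F) (hT : Function.Surjective fun a : F →L[𝕜] 𝕜 => a.comp T) :
    IsInducing T := by
  have hE := (PolynormableSpace.withSeminorms 𝕜 E).topologicalAddGroup
  refine ⟨le_antisymm T.continuous.le_induced (continuous_id_iff_le.mp ?_)⟩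
  refine @LinearMap.continuous_of_locally_bounded 𝕜 𝕜 E E _ (.induced T tF)
    (topologicalAddGroup_induced T) _ _ _ _ (continuousSMul_induced T) _ _ _ _
    (@TopologicalSpace.firstCountableTopology_induced E F _ _ T) _ LinearMap.id ?_
  intro s hs
  rw [LinearMap.id_coe, Set.image_id]
  refine isVonNBounded_of_forall_dual fun f => ?_
  obtain ⟨a, rfl⟩ := hT f
  let f : E →ₗ[𝕜] 𝕜 := a.toLinearMap ∘ₗ T.toLinearMap
  have hf : Continuous[.induced T tF, _] (a ∘ T) :=
    @Continuous.comp _ _ _ (.induced T tF) _ _ T a a.continuous continuous_induced_dom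
  exact @IsVonNBounded.exists_norm_le_of_continuous 𝕜 E _ _ _ (.induced T tF) s hs f hf

end WeaklyBounded

/-- A continuous linear map into a locally convex space whose transpose is injective has dense
range. -/
theorem ContinuousLinearMap.denseRange_of_transpose_injective {𝕜 E F : Type*} [RCLike 𝕜]
    [AddCommGroup E] [Module 𝕜 E] [TopologicalSpace E]
    [AddCommGroup F] [Module 𝕜 F] [TopologicalSpace F] [IsTopologicalAddGroup F]
    [ContinuousSMul 𝕜 F] [Module ℝ F] [IsScalarTower ℝ 𝕜 F] [LocallyConvexSpace ℝ F]
    (T : E →L[𝕜] F) (hT : Function.Injective fun a : F →L[𝕜] 𝕜 => a.comp T) :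
    DenseRange T := by
  have := IsScalarTower.continuousSMul (M := ℝ) (α := F) 𝕜
  intro y
  by_contra hy
  obtain ⟨f, u, hfu, hu⟩ := RCLike.geometric_hahn_banach_closed_point (𝕜 := 𝕜)
    (s := closure (Set.range T))
    ((T.toLinearMap.range.restrictScalars ℝ).convex.closure) isClosed_closure hy
  have hf : ∀ x, RCLike.re (f (T x)) < u := fun x => hfu _ (subset_closure ⟨x, rfl⟩)
  have h0 : f.comp T = 0 := by
    ext x
    by_contra hx
    have hx' : f (T x) ≠ 0 := hx
    have := hf ((((u + 1 : ℝ) : 𝕜) * (f (T x))⁻¹) • x)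
    rw [map_smul, map_smul, smul_eq_mul, mul_assoc, inv_mul_cancel₀ hx', mul_one,
      RCLike.ofReal_re] at this
    linarith
  have h1 : f = 0 := hT (by simpa using h0)
  have h2 := hf 0
  simp only [h1, zero_apply, map_zero] at h2 hu
  exact lt_asymm h2 hu

/-- A continuous linear map from a complete locally convex space to a metrizable locally convex
space is surjective if its transpose is bijective. -/
theorem ContinuousLinearMap.surjective_of_transpose_bijective {𝕜 E F : Type*} [RCLike 𝕜]
    [AddCommGroup E] [Module 𝕜 E] [UniformSpace E] [IsUniformAddGroup E] [CompleteSpace E]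
    [PolynormableSpace 𝕜 E]
    [AddCommGroup F] [Module 𝕜 F] [UniformSpace F] [IsUniformAddGroup F]
    [ContinuousSMul 𝕜 F] [Module ℝ F] [IsScalarTower ℝ 𝕜 F] [LocallyConvexSpace ℝ F]
    [FirstCountableTopology F] [T0Space F]
    (T : E →L[𝕜] F) (hT : Function.Bijective fun a : F →L[𝕜] 𝕜 => a.comp T) :
    Function.Surjective T := by
  have hind := AddMonoidHom.isUniformInducing_of_isInducing
    (T.isInducing_of_transpose_surjective hT.surjective)
  rw [← Set.range_eq_univ, ← (T.denseRange_of_transpose_injective hT.injective).closure_range]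
  exact hind.isComplete_range.isClosed.closure_eq.symm

namespace SchwartzMap

variable {E F : Type*} [NormedAddCommGroup E] [NormedSpace ℝ E] [NormedAddCommGroup F]
  [NormedSpace ℝ F] [CompleteSpace F]

/-- The norm of a derivative of a series of Schwartz functions is bounded by the seminorms. -/
theorem pow_mul_norm_tsum_iteratedFDeriv_le {f : ℕ → 𝓢(E, F)}
    (hf : ∀ k n, Summable fun i => SchwartzMap.seminorm ℝ k n (f i)) (k n : ℕ) (x : E) :
    ‖x‖ ^ k * ‖iteratedFDeriv ℝ n (fun y => ∑' i, f i y) x‖ ≤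
      ∑' i, SchwartzMap.seminorm ℝ k n (f i) := by
  rw [iteratedFDeriv_tsum_apply (N := ⊤) (fun i => (f i).smooth ⊤) (fun n _ => hf 0 n)
    (fun n i x _ => norm_iteratedFDeriv_le_seminorm ℝ (f i) n x) le_top]
  have h1 : Summable fun i => ‖iteratedFDeriv ℝ n (f i) x‖ :=
    (hf 0 n).of_nonneg_of_le (fun _ => norm_nonneg _)
      fun i => norm_iteratedFDeriv_le_seminorm ℝ (f i) n x
  calc _ ≤ ‖x‖ ^ k * ∑' i, ‖iteratedFDeriv ℝ n (f i) x‖ := by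
        gcongr
        exact norm_tsum_le_tsum_norm h1
    _ = ∑' i, ‖x‖ ^ k * ‖iteratedFDeriv ℝ n (f i) x‖ := tsum_mul_left.symm
    _ ≤ _ := (h1.mul_left _).tsum_le_tsum (fun i => le_seminorm ℝ k n (f i) x) (hf k n)

/-- The pointwise sum of an absolutely summable series of Schwartz functions. -/
noncomputable def pointwiseTsum (f : ℕ → 𝓢(E, F))
    (hf : ∀ k n, Summable fun i => SchwartzMap.seminorm ℝ k n (f i)) : 𝓢(E, F) where
  toFun x := ∑' i, f i x
  smooth' := contDiff_tsum (N := ⊤) (fun i => (f i).smooth ⊤) (fun n _ => hf 0 n)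
    (fun n i x _ => norm_iteratedFDeriv_le_seminorm ℝ (f i) n x)
  decay' k n := ⟨_, pow_mul_norm_tsum_iteratedFDeriv_le hf k n⟩

theorem seminorm_pointwiseTsum_le (f : ℕ → 𝓢(E, F))
    (hf : ∀ k n, Summable fun i => SchwartzMap.seminorm ℝ k n (f i)) (k n : ℕ) :
    SchwartzMap.seminorm ℝ k n (pointwiseTsum f hf) ≤
      ∑' i, SchwartzMap.seminorm ℝ k n (f i) :=
  seminorm_le_bound ℝ k n _ (tsum_nonneg fun _ => apply_nonneg _ _)
    (pow_mul_norm_tsum_iteratedFDeriv_le hf k n)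

theorem tendsto_sum_range_pointwiseTsum (f : ℕ → 𝓢(E, F))
    (hf : ∀ k n, Summable fun i => SchwartzMap.seminorm ℝ k n (f i)) :
    Tendsto (fun N => ∑ i ∈ Finset.range N, f i) atTop (𝓝 (pointwiseTsum f hf)) := by
  rw [(schwartz_withSeminorms ℝ E F).tendsto_nhds]
  rintro ⟨k, n⟩ ε hε
  have hf' N k n : Summable fun i => SchwartzMap.seminorm ℝ k n (f (i + N)) :=
    (summable_nat_add_iff N).mpr (hf k n)
  have hdiff N : pointwiseTsum f hf - ∑ i ∈ Finset.range N, f i =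
      pointwiseTsum (fun i => f (i + N)) (hf' N) := by
    ext x
    have hx : Summable fun i => f i x :=
      .of_norm_bounded (hf 0 0) fun i => norm_le_seminorm ℝ (f i) x
    change ∑' i, f i x - (∑ i ∈ Finset.range N, f i) x = ∑' i, f (i + N) x
    rw [← hx.sum_add_tsum_nat_add N]
    simp
  filter_upwards [(tendsto_sum_nat_add fun i => SchwartzMap.seminorm ℝ k n (f i)).eventually_lt_const
    hε] with N hN
  rw [schwartzSeminormFamily_apply, map_sub_rev, hdiff]
  exact (seminorm_pointwiseTsum_le _ _ k n).trans_lt hN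

instance instCompleteSpace : CompleteSpace 𝓢(E, F) := by
  have := IsUniformAddGroup.uniformity_countably_generated (α := 𝓢(E, F))
  refine UniformSpace.complete_of_convergent_controlled_sequences
    (fun N => {p | ∀ k ≤ N, ∀ n ≤ N, SchwartzMap.seminorm ℝ k n (p.2 - p.1) < (1 / 2) ^ N})
    (fun N => ?_) fun u hu => ?_
  · rw [uniformity_eq_comap_nhds_zero]
    refine ⟨{f | ∀ k ≤ N, ∀ n ≤ N, SchwartzMap.seminorm ℝ k n f < (1 / 2) ^ N}, ?_, fun _ h => h⟩
    change ∀ᶠ f in 𝓝 (0 : 𝓢(E, F)), ∀ k ≤ N, ∀ n ≤ N, _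
    refine (Set.finite_Iic N).eventually_all.mpr fun k _ =>
      (Set.finite_Iic N).eventually_all.mpr fun n _ => ?_
    have := ((schwartz_withSeminorms ℝ E F).continuous_seminorm (k, n)).tendsto 0
    rw [map_zero] at this
    exact this.eventually_lt_const (by positivity)
  · have hf k n : Summable fun i => SchwartzMap.seminorm ℝ k n (u (i + 1) - u i) := by
      refine summable_geometric_two.of_norm_bounded_eventually_nat ?_
      filter_upwards [eventually_ge_atTop k, eventually_ge_atTop n] with i hk hn
      rw [Real.norm_of_nonneg (apply_nonneg _ _)]
      exact (hu i i (i + 1) le_rfl i.le_succ k hk n hn).le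
    refine ⟨_, ((tendsto_sum_range_pointwiseTsum _ hf).add_const (u 0)).congr fun N => ?_⟩
    rw [Finset.sum_range_sub, sub_add_cancel]

end SchwartzMap

/-- If the transpose `ᵗT : 𝒮'_m → 𝒮'_n`, `a ↦ a ∘ T`, of a continuous linear operator
`T : 𝒮_n → 𝒮_m` is bijective, then `T` is surjective. -/
theorem surjective_of_transpose_bijective {n m : ℕ}
    (T : 𝓢((Fin n → ℝ), ℂ) →L[ℂ] 𝓢((Fin m → ℝ), ℂ))
    (hT : Function.Bijective
      (fun a : 𝓢((Fin m → ℝ), ℂ) →L[ℂ] ℂ => a.comp T)) :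
    Function.Surjective T := by
  have : PolynormableSpace ℂ 𝓢((Fin n → ℝ), ℂ) :=
    (schwartz_withSeminorms ℂ _ _).toPolynormableSpace
  exact T.surjective_of_transpose_bijective hT
end
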